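/- Global optimality of general subspace exclusion codes for χ² divergence (Theorem 9): assume κ ≥ 2, let u be an integer with 0 ≤ u ≤ κ−1, and let U be any u-dimensional subspace of W. Then for every q ∈ Δ satisfying (i) q(0) = 0, (ii) Σ_{v∈W} (q(v) − q̄(v))² = (2^u − 1)/((2^κ − 2^u)(2^κ − 1)), and (iii) Σ_{v∈W} (q(v) − q̌^{[S]}(v))² ≥ (2^{κ−1} − 2^u)/(2^{κ−1}(2^κ − 2^u)) for every (κ−1)-dimensional subspace S of W, one has λ(q̌^{[U]}) ≤ λ(q). -/

import Mathlib

attribute [local instance] Classical.propDecidable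

noncomputable instance {κ : ℕ} : Fintype (Submodule (ZMod 2) (Fin κ → ZMod 2)) :=
  haveI : Finite (Submodule (ZMod 2) (Fin κ → ZMod 2)) :=
    Finite.of_injective (fun S => (S : Set (Fin κ → ZMod 2))) SetLike.coe_injective
  Fintype.ofFinite _

/-- `ζ(S,q)`: the sum of `q v` over the vectors `v` lying in the subspace `S`. -/
noncomputable def zeta (κ : ℕ) (S : Submodule (ZMod 2) (Fin κ → ZMod 2))
    (q : (Fin κ → ZMod 2) → ℝ) : ℝ :=
  ∑ v : Fin κ → ZMod 2, if v ∈ S then q v else 0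

/-- The feasible simplex `Δ` of code-definition vectors. -/
def simplex (κ : ℕ) : Set ((Fin κ → ZMod 2) → ℝ) :=
  {q | (∀ v, 0 ≤ q v) ∧ ∑ v, q v = 1}

/-- The χ² divergence
`λ(q) = (2−ε)^n · 2^{−κ} · (1 + Σ_{dim S = κ−1} (ε/(2−ε))^{n(1−ζ(S,q))}) − 1`,
where the power with real exponent is the real power. -/
noncomputable def chiSq (κ n : ℕ) (ε : ℝ) (q : (Fin κ → ZMod 2) → ℝ) : ℝ :=
  (2 - ε) ^ n * (2 : ℝ) ^ (-(κ : ℤ)) *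
      (1 + ∑ S ∈ Finset.univ.filter
            (fun S : Submodule (ZMod 2) (Fin κ → ZMod 2) =>
              Module.finrank (ZMod 2) S = κ - 1),
          (ε / (2 - ε)) ^ ((n : ℝ) * (1 - zeta κ S q))) - 1

/-- The uniform vector fraction code: `q̄(0) = 0`, `q̄(v) = 1/(2^κ − 1)` for `v ≠ 0`. -/
noncomputable def qbar (κ : ℕ) : (Fin κ → ZMod 2) → ℝ :=
  fun v => if v = 0 then 0 else 1 / ((2 : ℝ) ^ κ - 1)

/-- The subspace exclusion code `q̌^{[U]}`: zero on `U`, `1/(2^κ − 2^u)` off `U`,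
where `u = dim U`. -/
noncomputable def qcheck (κ : ℕ) (U : Submodule (ZMod 2) (Fin κ → ZMod 2)) :
    (Fin κ → ZMod 2) → ℝ :=
  fun v => if v ∈ U then 0 else 1 / ((2 : ℝ) ^ κ - (2 : ℝ) ^ (Module.finrank (ZMod 2) U))

/-- The second-order Taylor remainder of `exp (-y)` at `0`, in integral form. -/
lemma exp_neg_eq_integral (y : ℝ) :
    Real.exp (-y) = 1 - y + y ^ 2 * ∫ s in (0 : ℝ)..1, (1 - s) * Real.exp (-(s * y)) := by
  have hderiv : ∀ s ∈ Set.uIcc (0 : ℝ) 1,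
      HasDerivAt (fun s : ℝ => (1 - (1 - s) * y) * Real.exp (-(s * y)))
        (y ^ 2 * ((1 - s) * Real.exp (-(s * y)))) s := by
    intro s _
    have h1 : HasDerivAt (fun s : ℝ => 1 - (1 - s) * y) y s := by
      simpa using (((hasDerivAt_id s).const_sub 1).mul_const y).const_sub 1
    have h2 : HasDerivAt (fun s : ℝ => Real.exp (-(s * y))) (Real.exp (-(s * y)) * -y) s := by
      simpa using (((hasDerivAt_id s).mul_const y).neg).exp
    exact (h1.mul h2).congr_deriv (by ring)
  have hint := intervalIntegral.integral_eq_sub_of_hasDerivAt hderiv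
    (Continuous.intervalIntegrable (by fun_prop) _ _)
  rw [intervalIntegral.integral_const_mul] at hint
  simp at hint
  linarith

lemma antitone_integral_exp_neg :
    Antitone fun y : ℝ => ∫ s in (0 : ℝ)..1, (1 - s) * Real.exp (-(s * y)) := by
  intro y z hyz
  refine intervalIntegral.integral_mono_on zero_le_one
    (Continuous.intervalIntegrable (by fun_prop) _ _)
    (Continuous.intervalIntegrable (by fun_prop) _ _) ?_
  intro s hs
  have h0 := hs.1
  refine mul_le_mul_of_nonneg_left (Real.exp_le_exp.2 ?_) (by linarith [hs.2])
  nlinarith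

/-- On `(-∞, b]` the exponential `exp (-t x)` dominates the quadratic that is tangent to it at `a`
and meets it again at `b`. -/
lemma exists_quadratic_le_exp_neg (t a b : ℝ) (ht : 0 ≤ t) :
    ∃ A B C : ℝ, (∀ x ≤ b, A + B * x + C * x ^ 2 ≤ Real.exp (-(t * x))) ∧
      ∀ x, x = a ∨ x = b → Real.exp (-(t * x)) = A + B * x + C * x ^ 2 := by
  set g : ℝ → ℝ := fun y => ∫ s in (0 : ℝ)..1, (1 - s) * Real.exp (-(s * y)) with hg
  have key : ∀ x, Real.exp (-(t * x)) = Real.exp (-(t * a)) *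
      (1 - t * (x - a) + (t * (x - a)) ^ 2 * g (t * (x - a))) := by
    intro x
    rw [hg, ← exp_neg_eq_integral, ← Real.exp_add]
    congr 1
    ring
  set E := Real.exp (-(t * a))
  set K := g (t * (b - a)) with hK
  have hquad : ∀ x, E * (1 + t * a + t ^ 2 * a ^ 2 * K) + E * (-t - 2 * t ^ 2 * a * K) * x +
      E * t ^ 2 * K * x ^ 2 = E * (1 - t * (x - a) + (t * (x - a)) ^ 2 * K) := fun x => by ring
  refine ⟨E * (1 + t * a + t ^ 2 * a ^ 2 * K), E * (-t - 2 * t ^ 2 * a * K), E * t ^ 2 * K, ?_, ?_⟩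
  · intro x hx
    rw [hquad, key]
    have hmono : K ≤ g (t * (x - a)) :=
      antitone_integral_exp_neg (mul_le_mul_of_nonneg_left (by linarith) ht)
    gcongr
  · intro x hx
    rw [hquad, key]
    rcases hx with rfl | rfl
    · simp
    · rfl

/-- The nontrivial character `ZMod 2 → {1, -1}`. -/
noncomputable def sgn (a : ZMod 2) : ℝ := if a = 0 then 1 else -1

lemma sgn_zero : sgn 0 = 1 := by simp [sgn]

lemma sgn_one : sgn 1 = -1 := by simp [sgn]

lemma sgn_add (a b : ZMod 2) : sgn (a + b) = sgn a * sgn b := by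
  have h2 : (1 : ZMod 2) + 1 = 0 := by decide
  have hcases : ∀ c : ZMod 2, c = 0 ∨ c = 1 := by decide
  rcases hcases a with rfl | rfl <;> rcases hcases b with rfl | rfl <;>
    simp [sgn_zero, sgn_one, h2]

lemma sum_sgn_eq_zero {G : Type*} [AddGroup G] [Fintype G] (f : G →+ ZMod 2) (g₀ : G)
    (h : f g₀ ≠ 0) : ∑ g, sgn (f g) = 0 := by
  have hshift : ∑ g, sgn (f (g₀ + g)) = ∑ g, sgn (f g) :=
    Fintype.sum_equiv (Equiv.addLeft g₀) _ _ fun _ => rfl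
  simp only [map_add, sgn_add, ← Finset.mul_sum] at hshift
  rw [sgn, if_neg h] at hshift
  linarith

section Moments

variable {κ : ℕ}

local notation "W" => (Fin κ → ZMod 2)

local notation "D" => (Module.Dual (ZMod 2) (Fin κ → ZMod 2))

noncomputable instance : Fintype D :=
  haveI : Finite D := DFunLike.finite _
  Fintype.ofFinite _

lemma sum_dual_sgn (v : W) (hv : v ≠ 0) : ∑ φ : D, sgn (φ v) = 0 := by
  obtain ⟨φ, hφ⟩ : ∃ φ : D, φ v ≠ 0 := by
    by_contra! h
    exact hv ((Module.forall_dual_apply_eq_zero_iff (ZMod 2) v).1 h)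
  exact sum_sgn_eq_zero (Module.Dual.eval (ZMod 2) W v).toAddMonoidHom φ hφ

/-- The Fourier coefficient of `q` at the functional `φ`. -/
noncomputable def fourierCoef (q : W → ℝ) (φ : D) : ℝ := ∑ v, q v * sgn (φ v)

lemma sum_fourier (q : W → ℝ) (hq0 : q 0 = 0) : ∑ φ : D, fourierCoef q φ = 0 := by
  simp only [fourierCoef]
  rw [Finset.sum_comm]
  refine Finset.sum_eq_zero fun v _ => ?_
  rw [← Finset.mul_sum]
  by_cases hv : v = 0
  · simp [hv, hq0]
  · simp [sum_dual_sgn v hv]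

lemma sum_fourier_sq (q : W → ℝ) :
    ∑ φ : D, fourierCoef q φ ^ 2 = Fintype.card D * ∑ v, q v ^ 2 := by
  have hpair : ∀ v w : W, ∑ φ : D, sgn (φ v) * sgn (φ w) =
      if v = w then (Fintype.card D : ℝ) else 0 := by
    intro v w
    simp only [← sgn_add, ← map_add]
    split_ifs with h
    · simp [h, CharTwo.add_self_eq_zero, sgn_zero]
    · exact sum_dual_sgn _ fun h0 => h (funext fun i => CharTwo.add_eq_zero.1 (congrFun h0 i))
  calc ∑ φ : D, fourierCoef q φ ^ 2
      = ∑ φ : D, ∑ v, ∑ w, q v * q w * (sgn (φ v) * sgn (φ w)) := by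
        refine Finset.sum_congr rfl fun φ _ => ?_
        rw [fourierCoef, sq, Finset.sum_mul_sum]
        refine Finset.sum_congr rfl fun v _ => Finset.sum_congr rfl fun w _ => by ring
    _ = ∑ v, ∑ w, q v * q w * ∑ φ : D, sgn (φ v) * sgn (φ w) := by
        rw [Finset.sum_comm]
        refine Finset.sum_congr rfl fun v _ => ?_
        rw [Finset.sum_comm]
        refine Finset.sum_congr rfl fun w _ => (Finset.mul_sum _ _ _).symm
    _ = Fintype.card D * ∑ v, q v ^ 2 := by
        simp only [hpair, mul_ite, mul_zero, Finset.sum_ite_eq, Finset.mem_univ, if_true,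
          Finset.mul_sum]
        refine Finset.sum_congr rfl fun v _ => by ring

lemma one_sub_zeta_ker (q : W → ℝ) (hq : ∑ v, q v = 1) (φ : D) :
    1 - zeta κ (LinearMap.ker φ) q = (1 - fourierCoef q φ) / 2 := by
  have h : fourierCoef q φ = 2 * zeta κ (LinearMap.ker φ) q - ∑ v, q v := by
    rw [fourierCoef, zeta, Finset.mul_sum, ← Finset.sum_sub_distrib]
    refine Finset.sum_congr rfl fun v _ => ?_
    rw [sgn, LinearMap.mem_ker]
    split_ifs <;> ring
  rw [h, hq]
  ring

variable (κ) in
/-- The hyperplanes, i.e. the subspaces of dimension `κ - 1`. -/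
noncomputable def hyperplanes : Finset (Submodule (ZMod 2) W) :=
  Finset.univ.filter fun S : Submodule (ZMod 2) W => Module.finrank (ZMod 2) S = κ - 1

lemma exists_dual_of_mem_hyperplanes (hκ : 1 ≤ κ) {S : Submodule (ZMod 2) W}
    (hS : Module.finrank (ZMod 2) S = κ - 1) : ∃ φ : D, φ ≠ 0 ∧ LinearMap.ker φ = S := by
  have hlt : S < ⊤ := by
    refine lt_top_iff_ne_top.2 fun h => ?_
    rw [h, finrank_top, Module.finrank_fin_fun] at hS
    omega
  obtain ⟨φ, hφ, hle⟩ := Submodule.exists_le_ker_of_lt_top S hlt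
  refine ⟨φ, hφ, (Submodule.eq_of_le_of_finrank_eq hle ?_).symm⟩
  have := Module.Dual.finrank_ker_add_one_of_ne_zero hφ
  rw [Module.finrank_fin_fun] at this
  omega

lemma sum_hyperplanes (hκ : 1 ≤ κ) (F : Submodule (ZMod 2) W → ℝ) (hF : F ⊤ = 0) :
    ∑ S ∈ hyperplanes κ, F S = ∑ φ : D, F (LinearMap.ker φ) := by
  rw [← Finset.sum_filter_add_sum_filter_not Finset.univ (fun φ : D => φ ≠ 0)]
  have hzero : ∑ φ : D with ¬ φ ≠ 0, F (LinearMap.ker φ) = 0 := by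
    refine Finset.sum_eq_zero fun φ hφ => ?_
    have : φ = 0 := by simpa using hφ
    rw [this, LinearMap.ker_zero, hF]
  rw [hzero, add_zero]
  symm
  refine Finset.sum_bij (fun φ _ => LinearMap.ker φ) ?_ ?_ ?_ fun _ _ => rfl
  · intro φ hφ
    have h := Module.Dual.finrank_ker_add_one_of_ne_zero (Finset.mem_filter.1 hφ).2
    rw [Module.finrank_fin_fun] at h
    exact Finset.mem_filter.2 ⟨Finset.mem_univ _, by omega⟩
  · intro φ _ ψ _ h
    have hbit : ∀ a b : ZMod 2, (a = 0 ↔ b = 0) → a = b := by decide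
    refine LinearMap.ext fun v => hbit _ _ ?_
    rw [← LinearMap.mem_ker, ← LinearMap.mem_ker, h]
  · intro S hS
    obtain ⟨φ, hφ, hker⟩ := exists_dual_of_mem_hyperplanes hκ (Finset.mem_filter.1 hS).2
    exact ⟨φ, Finset.mem_filter.2 ⟨Finset.mem_univ _, hφ⟩, hker⟩

lemma zeta_top (q : W → ℝ) : zeta κ ⊤ q = ∑ v, q v := by simp [zeta]

lemma sum_one_sub_zeta (hκ : 1 ≤ κ) (q : W → ℝ) (hq : ∑ v, q v = 1) (hq0 : q 0 = 0) :
    ∑ S ∈ hyperplanes κ, (1 - zeta κ S q) = Fintype.card D / 2 := by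
  rw [sum_hyperplanes hκ (fun S => 1 - zeta κ S q) (by simp [zeta_top, hq])]
  simp only [one_sub_zeta_ker q hq, ← Finset.sum_div, Finset.sum_sub_distrib, sum_fourier q hq0]
  simp

lemma sum_one_sub_zeta_sq (hκ : 1 ≤ κ) (q : W → ℝ) (hq : ∑ v, q v = 1) (hq0 : q 0 = 0) :
    ∑ S ∈ hyperplanes κ, (1 - zeta κ S q) ^ 2 =
      Fintype.card D * (1 + ∑ v, q v ^ 2) / 4 := by
  rw [sum_hyperplanes hκ (fun S => (1 - zeta κ S q) ^ 2) (by simp [zeta_top, hq])]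
  have hexp : ∀ φ : D, (1 - zeta κ (LinearMap.ker φ) q) ^ 2 =
      (1 - 2 * fourierCoef q φ + fourierCoef q φ ^ 2) / 4 := fun φ => by
    rw [one_sub_zeta_ker q hq]; ring
  simp only [hexp, ← Finset.sum_div, Finset.sum_add_distrib, Finset.sum_sub_distrib,
    ← Finset.mul_sum, sum_fourier q hq0, sum_fourier_sq]
  simp
  ring

lemma zeta_one (U : Submodule (ZMod 2) W) :
    zeta κ U (fun _ => 1) = 2 ^ Module.finrank (ZMod 2) U := by
  have h : Fintype.card U = 2 ^ Module.finrank (ZMod 2) U := by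
    rw [Module.card_eq_pow_finrank (K := ZMod 2) (V := U), ZMod.card]
  rw [zeta, Finset.sum_boole, ← Fintype.card_subtype]
  exact_mod_cast h

lemma sum_one_eq : ∑ _v : W, (1 : ℝ) = 2 ^ κ := by
  simp [ZMod.card]

lemma sum_qcheck_mul (U : Submodule (ZMod 2) W) (g : W → ℝ) :
    ∑ v, qcheck κ U v * g v =
      (∑ v, g v - zeta κ U g) / ((2 : ℝ) ^ κ - 2 ^ Module.finrank (ZMod 2) U) := by
  rw [zeta, ← Finset.sum_sub_distrib, Finset.sum_div]
  refine Finset.sum_congr rfl fun v _ => ?_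
  rw [qcheck]
  split_ifs <;> ring

lemma zeta_qcheck (U : Submodule (ZMod 2) W) : zeta κ U (qcheck κ U) = 0 :=
  Finset.sum_eq_zero fun v _ => by
    rw [qcheck]
    split_ifs <;> rfl

lemma two_pow_finrank_lt {U : Submodule (ZMod 2) W} (hU : Module.finrank (ZMod 2) U < κ) :
    (0 : ℝ) < 2 ^ κ - 2 ^ Module.finrank (ZMod 2) U :=
  sub_pos.2 (pow_lt_pow_right₀ one_lt_two hU)

lemma sum_qcheck {U : Submodule (ZMod 2) W} (hU : Module.finrank (ZMod 2) U < κ) :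
    ∑ v, qcheck κ U v = 1 := by
  have h := sum_qcheck_mul U fun _ => 1
  rw [sum_one_eq, zeta_one, div_self (two_pow_finrank_lt hU).ne'] at h
  simpa using h

lemma sum_qcheck_sq {U : Submodule (ZMod 2) W} (hU : Module.finrank (ZMod 2) U < κ) :
    ∑ v, qcheck κ U v ^ 2 = 1 / ((2 : ℝ) ^ κ - 2 ^ Module.finrank (ZMod 2) U) := by
  have h := sum_qcheck_mul U (qcheck κ U)
  rw [sum_qcheck hU, zeta_qcheck, sub_zero] at h
  simpa only [sq] using h

/-- The character sum of `φ` over `U` vanishes unless `φ` vanishes on `U`. -/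
lemma zeta_sgn (U : Submodule (ZMod 2) W) (φ : D) :
    zeta κ U (fun v => sgn (φ v)) =
      if U ≤ LinearMap.ker φ then 2 ^ Module.finrank (ZMod 2) U else 0 := by
  split_ifs with h
  · rw [← zeta_one]
    refine Finset.sum_congr rfl fun v _ => ?_
    split_ifs with hv
    · simp only [LinearMap.mem_ker.1 (h hv), sgn_zero]
    · rfl
  · obtain ⟨v, hv, hφ⟩ := SetLike.not_le_iff_exists.1 h
    rw [zeta, ← Finset.sum_filter,
      Finset.sum_subtype (p := fun v => v ∈ U) _ (by simp) (fun v => sgn (φ v))]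
    exact sum_sgn_eq_zero (φ.comp U.subtype).toAddMonoidHom (⟨v, hv⟩ : U) hφ

/-- A subspace exclusion code puts mass `1/2` or `2^κ / (2 (2^κ - 2^u))` off each hyperplane. -/
lemma one_sub_zeta_qcheck (hκ : 1 ≤ κ) {U S : Submodule (ZMod 2) W}
    (hU : Module.finrank (ZMod 2) U < κ) (hS : Module.finrank (ZMod 2) S = κ - 1) :
    1 - zeta κ S (qcheck κ U) = 1 / 2 ∨ 1 - zeta κ S (qcheck κ U) =
      2 ^ κ / (2 * ((2 : ℝ) ^ κ - 2 ^ Module.finrank (ZMod 2) U)) := by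
  obtain ⟨φ, hφ, rfl⟩ := exists_dual_of_mem_hyperplanes hκ hS
  have hpos := two_pow_finrank_lt hU
  have htot : ∑ v, sgn (φ v) = 0 := by
    obtain ⟨v, hv⟩ := DFunLike.ne_iff.1 hφ
    exact sum_sgn_eq_zero φ.toAddMonoidHom v hv
  have hfour := sum_qcheck_mul U fun v => sgn (φ v)
  rw [htot, zeta_sgn] at hfour
  rw [one_sub_zeta_ker _ (sum_qcheck hU), fourierCoef, hfour]
  split_ifs
  · right
    field_simp
    ring
  · left
    simp

lemma sum_sq_of_dist_qbar (hκ : 1 ≤ κ) {u : ℕ} (hu : u < κ) {q : W → ℝ} (hq : ∑ v, q v = 1)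
    (hq0 : q 0 = 0)
    (hrad : ∑ v, (q v - qbar κ v) ^ 2
      = ((2 : ℝ) ^ u - 1) / (((2 : ℝ) ^ κ - (2 : ℝ) ^ u) * ((2 : ℝ) ^ κ - 1))) :
    ∑ v, q v ^ 2 = 1 / ((2 : ℝ) ^ κ - 2 ^ u) := by
  have hN : (0 : ℝ) < 2 ^ κ - 1 := sub_pos.2 (one_lt_pow₀ one_lt_two (by omega))
  have hNM : (0 : ℝ) < 2 ^ κ - 2 ^ u := sub_pos.2 (pow_lt_pow_right₀ one_lt_two hu)
  have hpt : ∀ v, (q v - qbar κ v) ^ 2 = q v ^ 2 - 2 / ((2 : ℝ) ^ κ - 1) * q v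
      + (1 / ((2 : ℝ) ^ κ - 1) ^ 2 - if v = 0 then 1 / ((2 : ℝ) ^ κ - 1) ^ 2 else 0) := by
    intro v
    rw [qbar]
    split_ifs with hv
    · simp [hv, hq0]
    · rw [← one_div_pow]
      ring
  have hsum : ∑ _v : W, 1 / ((2 : ℝ) ^ κ - 1) ^ 2 = 2 ^ κ / ((2 : ℝ) ^ κ - 1) ^ 2 := by
    rw [← Finset.sum_div, sum_one_eq]
  simp only [hpt, Finset.sum_add_distrib, Finset.sum_sub_distrib, ← Finset.mul_sum, hq, hsum,
    Finset.sum_ite_eq', Finset.mem_univ, if_true] at hrad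
  have hconst : (2 : ℝ) ^ κ / (2 ^ κ - 1) ^ 2 - 1 / (2 ^ κ - 1) ^ 2 = 1 / (2 ^ κ - 1) := by
    field_simp
  have hsplit : ((2 : ℝ) ^ u - 1) / (((2 : ℝ) ^ κ - 2 ^ u) * (2 ^ κ - 1)) =
      1 / ((2 : ℝ) ^ κ - 2 ^ u) - 1 / (2 ^ κ - 1) := by
    field_simp
    ring
  have htwo : 2 / ((2 : ℝ) ^ κ - 1) = 2 * (1 / (2 ^ κ - 1)) := by ring
  linarith

lemma one_sub_zeta_le_of_dist_qcheck (hκ : 1 ≤ κ) {u : ℕ} (hu : u < κ) {q : W → ℝ}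
    (hq : ∑ v, q v = 1) (hsq : ∑ v, q v ^ 2 = 1 / ((2 : ℝ) ^ κ - 2 ^ u))
    {S : Submodule (ZMod 2) W} (hS : Module.finrank (ZMod 2) S = κ - 1)
    (hdist : ((2 : ℝ) ^ (κ - 1) - (2 : ℝ) ^ u) /
        ((2 : ℝ) ^ (κ - 1) * ((2 : ℝ) ^ κ - (2 : ℝ) ^ u))
          ≤ ∑ v, (q v - qcheck κ S v) ^ 2) :
    1 - zeta κ S q ≤ 2 ^ κ / (2 * ((2 : ℝ) ^ κ - 2 ^ u)) := by
  have hNM : (0 : ℝ) < 2 ^ κ - 2 ^ u := sub_pos.2 (pow_lt_pow_right₀ one_lt_two hu)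
  have hSκ : Module.finrank (ZMod 2) S < κ := by omega
  have hN : (2 : ℝ) ^ κ = 2 * 2 ^ (κ - 1) := by rw [← pow_succ']; congr 1; omega
  have hpt : ∀ v, (q v - qcheck κ S v) ^ 2 =
      q v ^ 2 - 2 * (qcheck κ S v * q v) + qcheck κ S v ^ 2 := fun v => by ring
  simp only [hpt, Finset.sum_add_distrib, Finset.sum_sub_distrib, ← Finset.mul_sum, hsq,
    sum_qcheck_mul, sum_qcheck_sq hSκ, hq, hS] at hdist
  have hP : (0 : ℝ) < 2 ^ (κ - 1) := by positivity
  rw [hN] at hdist hNM ⊢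
  generalize (2 : ℝ) ^ (κ - 1) = P at *
  generalize (2 : ℝ) ^ u = M at *
  have hPP : 2 * P - P = P := by ring
  rw [hPP] at hdist
  have hsplit : (P - M) / (P * (2 * P - M)) = 1 / P - 1 / (2 * P - M) := by
    rw [div_sub_div _ _ hP.ne' hNM.ne']
    congr 1
    ring
  rw [hsplit] at hdist
  have h : (1 - zeta κ S q) / P ≤ 1 / (2 * P - M) := by linarith
  rw [div_le_iff₀ hP] at h
  calc 1 - zeta κ S q ≤ 1 / (2 * P - M) * P := h
    _ = 2 * P / (2 * (2 * P - M)) := by field_simp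

end Moments

/-- Theorem 9: each subspace exclusion code globally minimizes the χ² divergence
subject to nonnegativity, unit sum, exclusion of the zero column, the fixed-radius
constraint, and a minimum distance from every first subspace exclusion code. -/
theorem SEC_global_opt_chiSq (κ n : ℕ) (hκ : 2 ≤ κ) (hn : 1 ≤ n)
    (ε : ℝ) (hε0 : 0 < ε) (hε1 : ε < 1)
    (u : ℕ) (hu : u ≤ κ - 1)
    (U : Submodule (ZMod 2) (Fin κ → ZMod 2))
    (hU : Module.finrank (ZMod 2) U = u)
    (q : (Fin κ → ZMod 2) → ℝ) (hq : q ∈ simplex κ) (hq0 : q 0 = 0)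
    (hrad : ∑ v, (q v - qbar κ v) ^ 2
      = ((2 : ℝ) ^ u - 1) / (((2 : ℝ) ^ κ - (2 : ℝ) ^ u) * ((2 : ℝ) ^ κ - 1)))
    (hdist : ∀ S : Submodule (ZMod 2) (Fin κ → ZMod 2),
      Module.finrank (ZMod 2) S = κ - 1 →
        ((2 : ℝ) ^ (κ - 1) - (2 : ℝ) ^ u) / ((2 : ℝ) ^ (κ - 1) * ((2 : ℝ) ^ κ - (2 : ℝ) ^ u))
          ≤ ∑ v, (q v - qcheck κ S v) ^ 2) :
    chiSq κ n ε (qcheck κ U) ≤ chiSq κ n ε q := by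
  subst hU
  have hUκ : Module.finrank (ZMod 2) U < κ := by omega
  have hκ1 : 1 ≤ κ := by omega
  have hsq := sum_sq_of_dist_qbar hκ1 hUκ hq.2 hq0 hrad
  have hcheck0 : qcheck κ U 0 = 0 := if_pos U.zero_mem
  have hc0 : 0 < ε / (2 - ε) := div_pos hε0 (by linarith)
  have hc1 : ε / (2 - ε) ≤ 1 := (div_le_one (by linarith)).2 (by linarith)
  set t : ℝ := -(n * Real.log (ε / (2 - ε)))
  have ht : 0 ≤ t :=
    neg_nonneg.2 (mul_nonpos_of_nonneg_of_nonpos n.cast_nonneg (Real.log_nonpos hc0.le hc1))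
  have hpow : ∀ x : ℝ, (ε / (2 - ε)) ^ ((n : ℝ) * x) = Real.exp (-(t * x)) := fun x => by
    rw [Real.rpow_def_of_pos hc0]
    congr 1
    ring
  obtain ⟨A, B, C, hle, heq⟩ := exists_quadratic_le_exp_neg t (1 / 2)
    (2 ^ κ / (2 * ((2 : ℝ) ^ κ - 2 ^ Module.finrank (ZMod 2) U))) ht
  have hmain : ∑ S ∈ hyperplanes κ, (ε / (2 - ε)) ^ ((n : ℝ) * (1 - zeta κ S (qcheck κ U))) ≤
      ∑ S ∈ hyperplanes κ, (ε / (2 - ε)) ^ ((n : ℝ) * (1 - zeta κ S q)) := by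
    calc ∑ S ∈ hyperplanes κ, (ε / (2 - ε)) ^ ((n : ℝ) * (1 - zeta κ S (qcheck κ U)))
        = ∑ S ∈ hyperplanes κ, (A + B * (1 - zeta κ S (qcheck κ U)) +
            C * (1 - zeta κ S (qcheck κ U)) ^ 2) :=
          Finset.sum_congr rfl fun S hS => by
            rw [hpow]
            exact heq _ (one_sub_zeta_qcheck hκ1 hUκ (Finset.mem_filter.1 hS).2)
      _ = ∑ S ∈ hyperplanes κ, (A + B * (1 - zeta κ S q) + C * (1 - zeta κ S q) ^ 2) := by
          simp only [Finset.sum_add_distrib, ← Finset.mul_sum]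
          rw [sum_one_sub_zeta hκ1 _ (sum_qcheck hUκ) hcheck0,
            sum_one_sub_zeta_sq hκ1 _ (sum_qcheck hUκ) hcheck0, sum_qcheck_sq hUκ,
            sum_one_sub_zeta hκ1 q hq.2 hq0, sum_one_sub_zeta_sq hκ1 q hq.2 hq0, hsq]
      _ ≤ ∑ S ∈ hyperplanes κ, (ε / (2 - ε)) ^ ((n : ℝ) * (1 - zeta κ S q)) :=
          Finset.sum_le_sum fun S hS => by
            have hS' := (Finset.mem_filter.1 hS).2
            rw [hpow]
            exact hle _ (one_sub_zeta_le_of_dist_qcheck hκ1 hUκ hq.2 hsq hS' (hdist S hS'))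
  have hfac : 0 ≤ (2 - ε) ^ n * (2 : ℝ) ^ (-(κ : ℤ)) :=
    mul_nonneg (pow_nonneg (by linarith) n) (by positivity)
  exact sub_le_sub_right (mul_le_mul_of_nonneg_left (add_le_add_right hmain 1) hfac) 1
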